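/- (Parametrized Bochner, hard direction) Let $S$ be a set and $\Gamma: S\times S\times\mathbb R^d\to\mathbb R$ such that for all $s_1,s_2$ the map $z\mapsto\Gamma(s_1,s_2,z)$ is continuous, and such that $K((s_1,x_1),(s_2,x_2)) = \Gamma(s_1,s_2,x_1-x_2)$ is a positive semi-definite kernel on $S\times\mathbb R^d$. Then there exists a family of finite complex Radon measures $(\mu_{s_1,s_2})_{s_1,s_2\in S}$ on $\mathbb R^d$ with $\Gamma(s_1,s_2,z) = \int e^{-i2\pi\xi^Tz}\,d\mu_{s_1,s_2}(\xi)$, and for all finite families $s_1,\dots,s_n\in S$ and $a_1,\dots,a_n\in\mathbb C$, the measure $\sum_{k,l} a_k\bar a_l \mu_{s_k,s_l}$ is positive. -/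

import Mathlib

open MeasureTheory Matrix

/-- Integration of a complex-valued function against a finite complex measure, via the
Jordan decompositions of its real and imaginary parts. -/
noncomputable def cmIntegral {α : Type*} [MeasurableSpace α]
    (c : MeasureTheory.ComplexMeasure α) (f : α → ℂ) : ℂ :=
  ((∫ x, f x ∂(c.re.toJordanDecomposition.posPart)) -
      ∫ x, f x ∂(c.re.toJordanDecomposition.negPart)) +
    Complex.I * ((∫ x, f x ∂(c.im.toJordanDecomposition.posPart)) -
      ∫ x, f x ∂(c.im.toJordanDecomposition.negPart))


section helpers

open scoped ComplexOrder ComplexConjugate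


/-- positive-definite functions -/
def BPD {E : Type*} [AddCommGroup E] (φ : E → ℂ) : Prop :=
  ∀ (n : ℕ) (x : Fin n → E) (a : Fin n → ℂ),
    0 ≤ ∑ k, ∑ l, a k * conj (a l) * φ (x k - x l)

lemma BPD.zero_nonneg {E : Type*} [AddCommGroup E] {φ : E → ℂ} (h : BPD φ) : 0 ≤ φ 0 := by
  simpa using h 1 (fun _ => 0) (fun _ => 1)

lemma BPD.norm_le {E : Type*} [AddCommGroup E] {φ : E → ℂ} (h : BPD φ) (x : E) :
    ‖φ x‖ ≤ (φ 0).re := by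
  have h0 := h.zero_nonneg
  have key : ∀ a b : ℂ, 0 ≤ (a * conj a + b * conj b) * φ 0 + a * conj b * φ x
      + b * conj a * φ (-x) := by
    intro a b
    have := h 2 ![x, 0] ![a, b]
    simp [Fin.sum_univ_two] at this
    convert this using 1
    ring
  have h1 := key 1 1
  have h2 := key 1 Complex.I
  rw [Complex.le_def] at h0 h1 h2
  obtain ⟨h0r, h0i⟩ := h0
  simp at h0r h0i
  have e1 := h1.2
  have e2 := h2.2
  simp [← h0i] at e1 e2
  have hneg : φ (-x) = conj (φ x) := by
    apply Complex.ext <;> simp <;> linarith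
  by_cases hx : φ x = 0
  · simpa [hx] using h0r
  have hn : (‖φ x‖ : ℂ) ≠ 0 := by simpa using hx
  have h3 := key (-(conj (φ x)) / ‖φ x‖) 1
  have e3 : (φ x) * conj (φ x) = ‖φ x‖ ^ 2 := by
    rw [Complex.mul_conj, Complex.normSq_eq_norm_sq]; simp
  have e4 : (-(conj (φ x)) / ‖φ x‖ * conj (-(conj (φ x)) / ‖φ x‖) + 1 * conj 1) * φ 0
      + (-(conj (φ x)) / ‖φ x‖) * conj 1 * φ x + 1 * conj (-(conj (φ x)) / ‖φ x‖) * φ (-x)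
      = 2 * φ 0 - 2 * ‖φ x‖ := by
    rw [hneg]
    simp
    field_simp
    linear_combination (φ 0 - 2 * ‖φ x‖) * e3
  rw [e4] at h3
  have := h3.1
  simp at this
  linarith

lemma BPD.integral_nonneg {E : Type*} [AddCommGroup E] [MeasurableSpace E] [MeasurableSub₂ E]
    {φ : E → ℂ} (h : BPD φ) (hφ : Measurable φ) (P : Measure E) [IsProbabilityMeasure P]
    (g : E → ℂ) (hg : Measurable g) (hg1 : ∀ x, ‖g x‖ ≤ 1) :
    0 ≤ ∫ p, g p.1 * conj (g p.2) * φ (p.1 - p.2) ∂(P.prod P) := by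
  set F : E × E → ℂ := fun p => g p.1 * conj (g p.2) * φ (p.1 - p.2) with hF
  have hFm : Measurable F := by
    have : Measurable (fun p : E × E => conj (g p.2)) :=
      Complex.continuous_conj.measurable.comp (hg.comp measurable_snd)
    exact ((hg.comp measurable_fst).mul this).mul (hφ.comp (measurable_fst.sub measurable_snd))
  have hFb : ∀ p, ‖F p‖ ≤ (φ 0).re := by
    intro p
    simp only [hF, norm_mul, RCLike.norm_conj]
    have := h.norm_le (p.1 - p.2)
    calc _ ≤ 1 * 1 * (φ 0).re := by
          gcongr
          · exact hg1 _
          · exact hg1 _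
      _ = _ := by ring
  set I := ∫ p, F p ∂(P.prod P) with hI
  set J := ∫ x, F (x, x) ∂P with hJ
  have hn : ∀ n : ℕ, 0 ≤ (n : ℂ) * J + (n : ℂ) * ((n : ℂ) - 1) * I := by
    intro n
    have e : ∀ k l : Fin n, ∫ ω, F (ω k, ω l) ∂(Measure.pi (fun _ : Fin n => P))
        = if k = l then J else I := by
      intro k l
      split_ifs with hkl
      · subst hkl
        have e1 : Measure.map (fun ω : Fin n → E => ω k) (Measure.pi (fun _ => P)) = P :=
          (measurePreserving_eval (fun _ : Fin n => P) k).map_eq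
        have e2 : J = ∫ x, F (x, x) ∂(Measure.map (fun ω : Fin n → E => ω k)
          (Measure.pi (fun _ => P))) := by rw [e1]
        rw [e2, integral_map]
        · exact (measurable_pi_apply k).aemeasurable
        · exact (hFm.comp (measurable_id.prodMk measurable_id)).aestronglyMeasurable
      · have hind := ProbabilityTheory.iIndepFun_pi (μ := fun _ : Fin n => P)
          (X := fun _ x => x) (fun i => aemeasurable_id)
        have := hind.indepFun hkl
        rw [ProbabilityTheory.indepFun_iff_map_prod_eq_prod_map_map
          (measurable_pi_apply k).aemeasurable (measurable_pi_apply l).aemeasurable] at this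
        have e1 := (measurePreserving_eval (fun _ : Fin n => P) k).map_eq
        have e2 := (measurePreserving_eval (fun _ : Fin n => P) l).map_eq
        have e1' : Measure.map (fun ω : Fin n → E => ω k) (Measure.pi (fun _ => P)) = P := e1
        have e2' : Measure.map (fun ω : Fin n → E => ω l) (Measure.pi (fun _ => P)) = P := e2
        rw [e1', e2'] at this
        rw [hI, ← this, integral_map]
        · exact ((measurable_pi_apply k).prodMk (measurable_pi_apply l)).aemeasurable
        · exact hFm.aestronglyMeasurable
    have hinteg : ∀ k l : Fin n, Integrable (fun ω : Fin n → E => F (ω k, ω l))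
        (Measure.pi (fun _ : Fin n => P)) := fun k l =>
      Integrable.of_bound (hFm.comp
        ((measurable_pi_apply k).prodMk (measurable_pi_apply l))).aestronglyMeasurable
        (φ 0).re (Filter.Eventually.of_forall fun ω => hFb _)
    have e3 : ∫ ω, (∑ k, ∑ l, F (ω k, ω l)) ∂(Measure.pi (fun _ : Fin n => P))
        = (n : ℂ) * J + (n : ℂ) * ((n : ℂ) - 1) * I := by
      rw [integral_finsetSum _ (fun k _ => integrable_finsetSum _ fun l _ => hinteg k l)]
      simp_rw [integral_finsetSum _ (fun l _ => hinteg _ l), e]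
      have : ∀ k l : Fin n, (if k = l then J else I) = I + if k = l then J - I else 0 := by
        intro k l; split_ifs <;> ring
      simp_rw [this, Finset.sum_add_distrib]
      simp
      ring
    rw [← e3]
    apply MeasureTheory.integral_nonneg
    intro ω
    exact h n ω (fun k => g (ω k))
  have hre : ∀ n : ℕ, 0 ≤ J.re + n * I.re ∧ J.im + n * I.im = 0 := by
    intro n
    have := hn (n + 1)
    have e : ((n + 1 : ℕ) : ℂ) * J + ((n + 1 : ℕ) : ℂ) * (((n + 1 : ℕ) : ℂ) - 1) * I
       = ((n + 1 : ℝ) : ℂ) * (J + (n : ℝ) * I) := by push_cast; ring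
    rw [e, Complex.le_def, Complex.re_ofReal_mul, Complex.im_ofReal_mul, Complex.add_re,
      Complex.add_im, Complex.re_ofReal_mul, Complex.im_ofReal_mul] at this
    simp only [Complex.zero_re, Complex.zero_im] at this
    have hp : (0 : ℝ) < n + 1 := by positivity
    constructor
    · exact nonneg_of_mul_nonneg_right this.1 hp
    · have := this.2.symm
      simpa [hp.ne'] using this
  rw [Complex.le_def]
  constructor
  · by_contra hc
    simp at hc
    obtain ⟨n, hn⟩ := exists_nat_gt (J.re / (-I.re))
    rw [div_lt_iff₀ (by linarith)] at hn
    have := (hre n).1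
    linarith
  · have a := (hre 0).2
    have b := (hre 1).2
    simp at a b ⊢
    linarith

open FourierTransform Real in
lemma BPD.fourier_nonneg {E : Type*} [NormedAddCommGroup E] [InnerProductSpace ℝ E]
    [FiniteDimensional ℝ E] [MeasurableSpace E] [BorelSpace E]
    {φ : E → ℂ} (h : BPD φ) (hφ : Continuous φ) (b : ℝ) (hb : 0 < b) (ξ : E) :
    0 ≤ 𝓕 (fun x => φ x * (rexp (-b * ‖x‖ ^ 2) : ℂ)) ξ := by
  have hgint : ∀ c : ℝ, 0 < c → Integrable (fun x : E => rexp (-c * ‖x‖ ^ 2)) := by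
    intro c hc
    by_contra hcon
    have h1 := GaussianFourier.integral_rexp_neg_mul_sq_norm (V := E) hc
    rw [integral_undef hcon] at h1
    have : 0 < (π / c) ^ (Module.finrank ℝ E / 2 : ℝ) := by positivity
    linarith
  have hgpos : ∀ c : ℝ, 0 < c → 0 < ∫ x : E, rexp (-c * ‖x‖ ^ 2) := by
    intro c hc
    rw [GaussianFourier.integral_rexp_neg_mul_sq_norm (V := E) hc]
    positivity
  set N := ∫ x : E, rexp (-(2 * b) * ‖x‖ ^ 2) with hN
  have hNpos : 0 < N := hgpos _ (by positivity)
  set G : E → ℝ := fun x => N⁻¹ * rexp (-(2 * b) * ‖x‖ ^ 2) with hG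
  have hGint : Integrable G := (hgint _ (by positivity)).const_mul _
  have hGnn : ∀ x, 0 ≤ G x := fun x => by positivity
  have hGm : Measurable G := by fun_prop
  have hGc : Continuous G := by fun_prop
  have hG1 : ∫ x, G x = 1 := by
    rw [hG, integral_const_mul]; exact inv_mul_cancel₀ hNpos.ne'
  set P : Measure E := volume.withDensity (fun x => ENNReal.ofReal (G x)) with hP
  have : IsProbabilityMeasure P := by
    constructor
    rw [hP, withDensity_apply _ MeasurableSet.univ, setLIntegral_univ,
      ← ofReal_integral_eq_lintegral_ofReal hGint (Filter.Eventually.of_forall hGnn), hG1]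
    simp
  have key := h.integral_nonneg hφ.measurable P (fun x => ((𝐞 (-(inner ℝ x ξ)) : Circle) : ℂ))
    (by fun_prop) (fun x => (Circle.norm_coe _).le)
  have hPP : P.prod P = (volume.prod volume).withDensity
      (fun p : E × E => ENNReal.ofReal (G p.1 * G p.2)) := by
    rw [hP, prod_withDensity (by fun_prop) (by fun_prop)]
    congr 1
    ext p
    rw [ENNReal.ofReal_mul (hGnn _)]
  rw [hPP, integral_withDensity_eq_integral_toReal_smul (by fun_prop)
    (Filter.Eventually.of_forall fun _ => ENNReal.ofReal_lt_top)] at key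
  have e1 : ∀ p : E × E, (ENNReal.ofReal (G p.1 * G p.2)).toReal •
      (((𝐞 (-(inner ℝ p.1 ξ)) : Circle) : ℂ) * conj ((𝐞 (-(inner ℝ p.2 ξ)) : Circle) : ℂ) * φ (p.1 - p.2))
      = ((G p.1 * G p.2 : ℝ) : ℂ) * (((𝐞 (-(inner ℝ (p.1 - p.2) ξ)) : Circle) : ℂ) * φ (p.1 - p.2)) := by
    intro p
    rw [ENNReal.toReal_ofReal (mul_nonneg (hGnn _) (hGnn _)), Complex.real_smul]
    congr 2
    rw [inner_sub_left, neg_sub, sub_eq_add_neg, add_comm, Real.fourierChar.map_add_eq_mul]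
    rw [← Circle.coe_inv_eq_conj, ← AddChar.map_neg_eq_inv]
    simp
  simp_rw [e1] at key
  set H : E × E → ℂ := fun p => ((G p.1 * G p.2 : ℝ) : ℂ) *
    (((𝐞 (-(inner ℝ (p.1 - p.2) ξ)) : Circle) : ℂ) * φ (p.1 - p.2)) with hH
  have hHc : Continuous H := by fun_prop
  have hHint : Integrable H (volume.prod volume) := by
    have : Integrable (fun p : E × E => G p.1 * G p.2 * (φ 0).re) (volume.prod volume) :=
      (hGint.mul_prod hGint).mul_const _
    refine this.mono' hHc.aestronglyMeasurable (Filter.Eventually.of_forall fun p => ?_)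
    simp only [hH, norm_mul, Circle.norm_coe, one_mul, Complex.norm_real]
    rw [Real.norm_of_nonneg (hGnn _), Real.norm_of_nonneg (hGnn _)]
    have := h.norm_le (p.1 - p.2)
    have := hGnn p.1
    have := hGnn p.2
    gcongr
  have hmp := measurePreserving_add_prod (volume : Measure E) (volume : Measure E)
  have e2 : ∫ p, H p ∂(volume.prod volume) = ∫ p : E × E, H (p.1 + p.2, p.2) ∂(volume.prod volume) := by
    conv_lhs => rw [← hmp.map_eq]
    rw [integral_map hmp.aemeasurable hHc.aestronglyMeasurable]
  have hHint2 : Integrable (fun p : E × E => H (p.1 + p.2, p.2)) (volume.prod volume) :=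
    hmp.integrable_comp_of_integrable hHint
  have key2 : 0 ≤ ∫ p, H p ∂(volume.prod volume) := key
  rw [e2, integral_prod _ hHint2] at key2
  set K := ∫ x : E, rexp (-(4 * b) * ‖x‖ ^ 2) with hK
  have hKpos : 0 < K := hgpos _ (by positivity)
  have e3 : ∀ u : E, ∫ y, H (u + y, y) = ((N⁻¹ ^ 2 * K : ℝ) : ℂ) *
      (((𝐞 (-(inner ℝ u ξ)) : Circle) : ℂ) * (φ u * (rexp (-b * ‖u‖ ^ 2) : ℂ))) := by
    intro u
    have e4 : ∀ y, H (u + y, y) = ((rexp (-(4 * b) * ‖y + (2⁻¹ : ℝ) • u‖ ^ 2) : ℝ) : ℂ) *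
       (((N⁻¹ ^ 2 * rexp (-b * ‖u‖ ^ 2) : ℝ) : ℂ) * (((𝐞 (-(inner ℝ u ξ)) : Circle) : ℂ) * φ u)) := by
      intro y
      simp only [hH, hG, add_sub_cancel_right]
      rw [← mul_assoc _ _ (_ * _), ← Complex.ofReal_mul]
      congr 2
      have : rexp (-(2 * b) * ‖u + y‖ ^ 2) * rexp (-(2 * b) * ‖y‖ ^ 2) =
        rexp (-(4 * b) * ‖y + (2⁻¹ : ℝ) • u‖ ^ 2) * rexp (-b * ‖u‖ ^ 2) := by
        rw [← Real.exp_add, ← Real.exp_add]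
        congr 1
        rw [norm_add_sq_real, norm_add_sq_real, norm_smul, real_inner_smul_right,
          real_inner_comm u y]
        simp
        ring
      linear_combination N⁻¹ ^ 2 * this
    simp_rw [e4]
    rw [integral_mul_const, integral_complex_ofReal,
      integral_add_right_eq_self (fun y : E => rexp (-(4 * b) * ‖y‖ ^ 2))]
    push_cast
    ring
  simp_rw [e3] at key2
  rw [integral_const_mul] at key2
  have hpos : 0 < N⁻¹ ^ 2 * K := by positivity
  rw [Real.fourier_eq]
  have : ∀ z : ℂ, 0 ≤ ((N⁻¹ ^ 2 * K : ℝ) : ℂ) * z → 0 ≤ z := by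
    intro z hz
    rw [Complex.le_def, Complex.re_ofReal_mul, Complex.im_ofReal_mul] at hz
    rw [Complex.le_def]
    simp only [Complex.zero_re, Complex.zero_im] at hz ⊢
    exact ⟨nonneg_of_mul_nonneg_right hz.1 hpos, by
      have := hz.2.symm; rw [mul_eq_zero] at this; exact (this.resolve_left hpos.ne').symm⟩
  have := this _ key2
  simpa [Circle.smul_def] using this

open FourierTransform Real in
lemma bochner_fourier_integrable {E : Type*} [NormedAddCommGroup E] [InnerProductSpace ℝ E]
    [FiniteDimensional ℝ E] [MeasurableSpace E] [BorelSpace E]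
    {ψ : E → ℂ} (hi : Integrable ψ) (M : ℝ) (hM : ∀ x, ‖ψ x‖ ≤ M)
    (hpos : ∀ ξ, 0 ≤ 𝓕 ψ ξ) : Integrable (𝓕 ψ) := by
  have hcont : Continuous (𝓕 ψ) :=
    VectorFourier.fourierIntegral_continuous continuous_fourierChar
      (L := innerₗ E) continuous_inner hi
  have hM0 : 0 ≤ M := (norm_nonneg _).trans (hM 0)
  have hgint : ∀ c : ℝ, 0 < c → Integrable (fun x : E => rexp (-c * ‖x‖ ^ 2)) := by
    intro c hc
    by_contra hcon
    have h1 := GaussianFourier.integral_rexp_neg_mul_sq_norm (V := E) hc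
    rw [integral_undef hcon] at h1
    have : 0 < (π / c) ^ (Module.finrank ℝ E / 2 : ℝ) := by positivity
    linarith
  have hz : ∀ z : ℂ, 0 ≤ z → z = (‖z‖ : ℂ) := fun z hz => by
    rw [Complex.norm_of_nonneg' hz]
  have hbd : ∀ x, ‖𝓕 ψ x‖ ≤ ∫ v, ‖ψ v‖ := fun x =>
    VectorFourier.norm_fourierIntegral_le_integral_norm _ _ _ _ _
  have main : ∀ b : ℝ, 0 < b → ∫⁻ x, ‖𝓕 ψ x * (rexp (-b * ‖x‖ ^ 2) : ℂ)‖ₑ ≤ ENNReal.ofReal M := by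
    intro b hb
    have hg := (hgint b hb).ofReal (𝕜 := ℂ)
    have hinteg : Integrable (fun x => 𝓕 ψ x * (rexp (-b * ‖x‖ ^ 2) : ℂ)) :=
      hg.bdd_mul hcont.aestronglyMeasurable (Filter.Eventually.of_forall hbd)
    have e1 : ∫ x, 𝓕 ψ x * (rexp (-b * ‖x‖ ^ 2) : ℂ) =
        ∫ x, ψ x * 𝓕 (fun x : E => (rexp (-b * ‖x‖ ^ 2) : ℂ)) x := by
      simpa using! VectorFourier.integral_bilin_fourierIntegral_eq_flip (.mul ℂ ℂ) (L := innerₗ E)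
        continuous_fourierChar continuous_inner hi hg
    have e2 : ∀ x, ‖𝓕 (fun x : E => (rexp (-b * ‖x‖ ^ 2) : ℂ)) x‖ =
        (π / b) ^ (Module.finrank ℝ E / 2 : ℝ) * rexp (-(π ^ 2 / b) * ‖x‖ ^ 2) := by
      intro x
      have := fourier_gaussian_innerProductSpace (V := E) (b := (b : ℂ)) (by simpa using hb) x
      have e : (fun x : E => (rexp (-b * ‖x‖ ^ 2) : ℂ)) =
        fun x : E => Complex.exp (-(b : ℂ) * (‖x‖ : ℂ) ^ 2) := by ext; push_cast; rfl
      rw [e, this]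
      have e' : ((π : ℂ) / b) ^ (Module.finrank ℝ E / 2 : ℂ) =
          (((π / b) ^ (Module.finrank ℝ E / 2 : ℝ) : ℝ) : ℂ) := by
        rw [Complex.ofReal_cpow (by positivity)]; push_cast; rfl
      have e'' : Complex.exp (-(π : ℂ) ^ 2 * (‖x‖ : ℂ) ^ 2 / b) =
          ((rexp (-(π ^ 2 / b) * ‖x‖ ^ 2) : ℝ) : ℂ) := by
        push_cast; congr 1; ring
      rw [e', e'', norm_mul, Complex.norm_real, Complex.norm_real, Real.norm_of_nonneg (by positivity),
        Real.norm_of_nonneg (by positivity)]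
    have e3 : ∫ x : E, ‖𝓕 (fun x : E => (rexp (-b * ‖x‖ ^ 2) : ℂ)) x‖ = 1 := by
      simp_rw [e2]
      rw [integral_const_mul, GaussianFourier.integral_rexp_neg_mul_sq_norm (by positivity),
        ← Real.mul_rpow (by positivity) (by positivity)]
      have : π / b * (π / (π ^ 2 / b)) = 1 := by field_simp
      rw [this, Real.one_rpow]
    have e4 : ‖∫ x, 𝓕 ψ x * (rexp (-b * ‖x‖ ^ 2) : ℂ)‖ ≤ M := by
      rw [e1]
      have hI : Integrable (fun x : E => ‖𝓕 (fun x : E => (rexp (-b * ‖x‖ ^ 2) : ℂ)) x‖) := by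
        by_contra hcon
        rw [integral_undef hcon] at e3
        norm_num at e3
      calc _ ≤ ∫ x, M * ‖𝓕 (fun x : E => (rexp (-b * ‖x‖ ^ 2) : ℂ)) x‖ := by
            apply norm_integral_le_of_norm_le (hI.const_mul M)
            refine Filter.Eventually.of_forall fun x => ?_
            rw [norm_mul]
            gcongr
            exact hM x
        _ = M := by rw [integral_const_mul, e3, mul_one]
    have e5 : ∫ x, 𝓕 ψ x * (rexp (-b * ‖x‖ ^ 2) : ℂ) =
        ((∫ x, ‖𝓕 ψ x * (rexp (-b * ‖x‖ ^ 2) : ℂ)‖ : ℝ) : ℂ) := by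
      rw [← integral_complex_ofReal]
      congr 1
      ext x
      apply hz
      apply mul_nonneg (hpos x)
      exact_mod_cast (Real.exp_pos _).le
    rw [← ofReal_integral_norm_eq_lintegral_enorm hinteg]
    apply ENNReal.ofReal_le_ofReal
    rw [e5, Complex.norm_real, Real.norm_of_nonneg (by positivity)] at e4
    exact e4
  refine ⟨hcont.aestronglyMeasurable, ?_⟩
  have lim : ∀ x, Filter.Tendsto (fun n : ℕ => ‖𝓕 ψ x * (rexp (-(1 / ((n : ℝ) + 1)) * ‖x‖ ^ 2) : ℂ)‖ₑ)
      Filter.atTop (nhds ‖𝓕 ψ x‖ₑ) := by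
    intro x
    apply Filter.Tendsto.enorm
    have h1 := (tendsto_one_div_add_atTop_nhds_zero_nat (𝕜 := ℝ)).neg.mul_const (‖x‖ ^ 2)
    have h2 := (Complex.continuous_ofReal.tendsto _).comp ((Real.continuous_exp.tendsto _).comp h1)
    have h3 := h2.const_mul (𝓕 ψ x)
    simpa using! h3
  have : ∫⁻ x, ‖𝓕 ψ x‖ₑ ≤ ENNReal.ofReal M := by
    calc ∫⁻ x, ‖𝓕 ψ x‖ₑ = ∫⁻ x, Filter.liminf (fun n : ℕ =>
          ‖𝓕 ψ x * (rexp (-(1 / ((n : ℝ) + 1)) * ‖x‖ ^ 2) : ℂ)‖ₑ) Filter.atTop := by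
          congr 1; ext x; exact (lim x).liminf_eq.symm
      _ ≤ Filter.liminf (fun n : ℕ => ∫⁻ x,
          ‖𝓕 ψ x * (rexp (-(1 / ((n : ℝ) + 1)) * ‖x‖ ^ 2) : ℂ)‖ₑ) Filter.atTop := by
          apply lintegral_liminf_le
          intro n
          have : Continuous fun x => 𝓕 ψ x * (rexp (-(1 / ((n : ℝ) + 1)) * ‖x‖ ^ 2) : ℂ) := by
            fun_prop
          exact this.measurable.enorm
      _ ≤ Filter.liminf (fun n : ℕ => ENNReal.ofReal M) Filter.atTop := by
          refine Filter.liminf_le_liminf ?_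
          exact Filter.Eventually.of_forall fun n => main _ (by positivity)
      _ = _ := by simp
  exact this.trans_lt ENNReal.ofReal_lt_top

open FourierTransform Real in
lemma BPD.approx {E : Type*} [NormedAddCommGroup E] [InnerProductSpace ℝ E]
    [FiniteDimensional ℝ E] [MeasurableSpace E] [BorelSpace E]
    {φ : E → ℂ} (h : BPD φ) (hφ : Continuous φ) (h1 : φ 0 = 1) (b : ℝ) (hb : 0 < b) :
    ∃ μ : ProbabilityMeasure E, ∀ v, charFun (μ : Measure E) ((2 * π) • v) =
      φ v * (rexp (-b * ‖v‖ ^ 2) : ℂ) := by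
  have hpos := h.fourier_nonneg hφ b hb
  set ψ : E → ℂ := fun x => φ x * (rexp (-b * ‖x‖ ^ 2) : ℂ) with hψ
  have hgint : Integrable (fun x : E => rexp (-b * ‖x‖ ^ 2)) := by
    by_contra hcon
    have h1 := GaussianFourier.integral_rexp_neg_mul_sq_norm (V := E) hb
    rw [integral_undef hcon] at h1
    have : 0 < (π / b) ^ (Module.finrank ℝ E / 2 : ℝ) := by positivity
    linarith
  have hc : Continuous ψ := by fun_prop
  have hi : Integrable ψ :=
    (hgint.ofReal (𝕜 := ℂ)).bdd_mul hφ.aestronglyMeasurable (Filter.Eventually.of_forall h.norm_le)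
  have hψ1 : ∀ x, ‖ψ x‖ ≤ 1 := by
    intro x
    have := h.norm_le x
    rw [h1] at this
    simp only [hψ, norm_mul, Complex.norm_real]
    rw [Real.norm_of_nonneg (by positivity)]
    have h2 : rexp (-b * ‖x‖ ^ 2) ≤ 1 := by
      rw [Real.exp_le_one_iff]; nlinarith [sq_nonneg ‖x‖]
    have h3 : ‖φ x‖ ≤ 1 := by simpa using this
    exact mul_le_one₀ h3 (by positivity) h2
  have hFi := bochner_fourier_integrable hi 1 hψ1 hpos
  have hcont : Continuous (𝓕 ψ) :=
    VectorFourier.fourierIntegral_continuous continuous_fourierChar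
      (L := innerₗ E) continuous_inner hi
  have hinv := hc.fourierInv_fourier_eq hi hFi
  have hre : ∀ x, 0 ≤ (𝓕 ψ x).re := fun x => (Complex.le_def.1 (hpos x)).1
  have hre' : ∀ x, (((𝓕 ψ x).re : ℝ) : ℂ) = 𝓕 ψ x := fun x => by
    apply Complex.ext
    · simp
    · simpa using (Complex.le_def.1 (hpos x)).2
  set μ : Measure E := volume.withDensity (fun x => ENNReal.ofReal (𝓕 ψ x).re) with hμ
  have hm : Measurable (fun x => ENNReal.ofReal (𝓕 ψ x).re) := by fun_prop
  have hch : ∀ v, charFun μ ((2 * π) • v) = ψ v := by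
    intro v
    rw [charFun_apply, hμ, integral_withDensity_eq_integral_toReal_smul hm
      (Filter.Eventually.of_forall fun _ => ENNReal.ofReal_lt_top), ← congrFun hinv v, Real.fourierInv_eq']
    congr 1
    ext x
    rw [ENNReal.toReal_ofReal (hre x), Complex.real_smul, hre', smul_eq_mul, mul_comm,
      real_inner_smul_right]
  have hfin : IsFiniteMeasure μ := by
    constructor
    rw [hμ, withDensity_apply _ MeasurableSet.univ, setLIntegral_univ,
      ← ofReal_integral_eq_lintegral_ofReal (f := fun x => (𝓕 ψ x).re) hFi.re
        (Filter.Eventually.of_forall hre)]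
    exact ENNReal.ofReal_lt_top
  have hp : IsProbabilityMeasure μ := by
    have := hch 0
    rw [smul_zero, charFun_zero] at this
    have h2 : ψ 0 = 1 := by simp [hψ, h1]
    rw [h2] at this
    exact isProbabilityMeasure_iff_real.2 (by exact_mod_cast this)
  exact ⟨⟨μ, hp⟩, hch⟩

open Real in
lemma BPD.bochner_one {E : Type*} [NormedAddCommGroup E] [InnerProductSpace ℝ E]
    [FiniteDimensional ℝ E] [MeasurableSpace E] [BorelSpace E]
    {φ : E → ℂ} (h : BPD φ) (hφ : Continuous φ) (h1 : φ 0 = 1) :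
    ∃ μ : ProbabilityMeasure E, ∀ v, charFun (μ : Measure E) ((2 * π) • v) = φ v := by
  have hb : ∀ n : ℕ, (0 : ℝ) < 1 / ((n : ℝ) + 1) := fun n => by positivity
  choose μ hμ using fun n : ℕ => h.approx hφ h1 _ (hb n)
  have hpi : (2 * π) ≠ 0 := by positivity
  have hlim0 : ∀ v, Filter.Tendsto (fun n => charFun (μ n : Measure E) ((2 * π) • v)) Filter.atTop
      (nhds (φ v)) := by
    intro v
    simp_rw [hμ]
    have h1 := (tendsto_one_div_add_atTop_nhds_zero_nat (𝕜 := ℝ)).neg.mul_const (‖v‖ ^ 2)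
    have h2 := (Complex.continuous_ofReal.tendsto _).comp ((Real.continuous_exp.tendsto _).comp h1)
    have h3 := h2.const_mul (φ v)
    simpa using! h3
  have hlim : ∀ t, Filter.Tendsto (fun n => charFun (μ n : Measure E) t) Filter.atTop
      (nhds (φ ((2 * π)⁻¹ • t))) := by
    intro t
    have := hlim0 ((2 * π)⁻¹ • t)
    rwa [smul_smul, mul_inv_cancel₀ hpi, one_smul] at this
  have htight := isTightMeasureSet_of_tendsto_charFun (μ := fun n => (μ n : Measure E))
    (f := fun t => φ ((2 * π)⁻¹ • t)) (by fun_prop) hlim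
  have hcomp : IsCompact (closure (Set.range μ)) := by
    apply isCompact_closure_of_isTightMeasureSet
    convert htight using 1
    ext ν
    simp
  obtain ⟨μ', -, hμ'⟩ := hcomp.exists_mapClusterPt (f := Filter.atTop) (u := μ)
    (Filter.tendsto_principal.2 (Filter.Eventually.of_forall fun n =>
      subset_closure (Set.mem_range_self n)))
  obtain ⟨U, hU, hUt⟩ := mapClusterPt_iff_ultrafilter.1 hμ'
  refine ⟨μ', fun v => ?_⟩
  rw [ProbabilityMeasure.tendsto_iff_forall_integral_rclike_tendsto ℂ] at hUt
  have := hUt (BoundedContinuousFunction.innerProbChar ((2 * π) • v))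
  simp_rw [← charFun_eq_integral_innerProbChar] at this
  exact tendsto_nhds_unique this ((hlim0 v).mono_left hU)

open Real in
lemma BPD.bochner {E : Type*} [NormedAddCommGroup E] [InnerProductSpace ℝ E]
    [FiniteDimensional ℝ E] [MeasurableSpace E] [BorelSpace E]
    {φ : E → ℂ} (h : BPD φ) (hφ : Continuous φ) :
    ∃ μ : FiniteMeasure E, ∀ v, charFun (μ : Measure E) ((2 * π) • v) = φ v := by
  have h0 := Complex.le_def.1 h.zero_nonneg
  by_cases hz : φ 0 = 0
  · refine ⟨0, fun v => ?_⟩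
    have := h.norm_le v
    rw [hz] at this
    have : φ v = 0 := by simpa using this
    simp [this]
  set c : ℝ := (φ 0).re with hc
  have hc0 : (c : ℂ) = φ 0 := by
    apply Complex.ext
    · simp [hc]
    · simpa using h0.2
  have hcpos : 0 < c := lt_of_le_of_ne (by simpa using h0.1) (fun e => hz (by rw [← hc0, ← e]; simp))
  have hB : BPD (fun x => ((c⁻¹ : ℝ) : ℂ) * φ x) := by
    intro n x a
    have : ∑ k, ∑ l, a k * conj (a l) * (((c⁻¹ : ℝ) : ℂ) * φ (x k - x l)) =
      ((c⁻¹ : ℝ) : ℂ) * ∑ k, ∑ l, a k * conj (a l) * φ (x k - x l) := by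
      simp_rw [Finset.mul_sum]
      refine Finset.sum_congr rfl fun k _ => Finset.sum_congr rfl fun l _ => by ring
    rw [this]
    apply mul_nonneg _ (h n x a)
    exact_mod_cast (inv_pos.2 hcpos).le
  obtain ⟨μ, hμ⟩ := hB.bochner_one (by fun_prop) (by
    simp only [← hc0]; rw [← Complex.ofReal_mul, inv_mul_cancel₀ hcpos.ne']; simp)
  refine ⟨c.toNNReal • μ.toFiniteMeasure, fun v => ?_⟩
  have := hμ v
  have e : charFun ((c.toNNReal • μ.toFiniteMeasure : FiniteMeasure E) : Measure E) ((2 * π) • v)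
    = (c : ℂ) * charFun (μ : Measure E) ((2 * π) • v) := by
    rw [charFun_apply, charFun_apply, FiniteMeasure.toMeasure_smul, integral_smul_nnreal_measure]
    simp [NNReal.smul_def, hcpos.le]
  rw [e, this, ← mul_assoc, ← Complex.ofReal_mul, mul_inv_cancel₀ hcpos.ne']
  simp

/-- the Fourier transform of a measure, in the normalization of the theorem -/
noncomputable def bT {d : ℕ} (m : Measure (Fin d → ℝ)) (z : Fin d → ℝ) : ℂ :=
  ∫ ξ, Complex.exp (-(2 * Real.pi * Complex.I * ((ξ ⬝ᵥ z : ℝ) : ℂ))) ∂m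

lemma bT_integrable {d : ℕ} (m : Measure (Fin d → ℝ)) [IsFiniteMeasure m] (z : Fin d → ℝ) :
    Integrable (fun ξ : Fin d → ℝ =>
      Complex.exp (-(2 * Real.pi * Complex.I * ((ξ ⬝ᵥ z : ℝ) : ℂ)))) m := by
  apply Integrable.of_bound (C := 1)
  · apply Continuous.aestronglyMeasurable
    have : Continuous fun ξ : Fin d → ℝ => ξ ⬝ᵥ z := by
      unfold dotProduct; fun_prop
    fun_prop
  · filter_upwards with ξ
    have : -(2 * Real.pi * Complex.I * ((ξ ⬝ᵥ z : ℝ) : ℂ))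
      = ((-(2 * Real.pi * (ξ ⬝ᵥ z)) : ℝ) : ℂ) * Complex.I := by push_cast; ring
    rw [this, Complex.norm_exp_ofReal_mul_I]

lemma bT_eq {d : ℕ} (m : Measure (Fin d → ℝ)) (z : Fin d → ℝ) :
    bT m z = charFun (m.map (WithLp.toLp 2 : (Fin d → ℝ) → EuclideanSpace ℝ (Fin d)))
      (-((2 * Real.pi) • WithLp.toLp 2 z)) := by
  rw [charFun_apply, bT]
  have : Measurable (WithLp.toLp 2 : (Fin d → ℝ) → EuclideanSpace ℝ (Fin d)) := by fun_prop
  rw [integral_map this.aemeasurable (by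
    apply Continuous.aestronglyMeasurable; fun_prop)]
  congr 1; ext ξ; congr 1
  rw [inner_neg_right, inner_smul_right, EuclideanSpace.inner_toLp_toLp, dotProduct_comm]
  simp
  ring

lemma bT_conj {d : ℕ} (m : Measure (Fin d → ℝ)) (z : Fin d → ℝ) :
    bT m (-z) = conj (bT m z) := by
  simp only [bT]
  rw [← integral_conj]
  congr 1; ext ξ
  rw [← Complex.exp_conj]
  congr 1
  have h2 : conj (2 : ℂ) = 2 := Complex.conj_ofNat 2
  simp [dotProduct_neg, h2]

lemma bT_ext {d : ℕ} (m m' : Measure (Fin d → ℝ)) [IsFiniteMeasure m] [IsFiniteMeasure m']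
    (h : ∀ z, bT m z = bT m' z) : m = m' := by
  have hm : Measurable (WithLp.toLp 2 : (Fin d → ℝ) → EuclideanSpace ℝ (Fin d)) := by fun_prop
  have hm2 : Measurable (WithLp.ofLp : EuclideanSpace ℝ (Fin d) → (Fin d → ℝ)) := by fun_prop
  have key : m.map (WithLp.toLp 2 : (Fin d → ℝ) → EuclideanSpace ℝ (Fin d))
      = m'.map (WithLp.toLp 2 : (Fin d → ℝ) → EuclideanSpace ℝ (Fin d)) := by
    apply Measure.ext_of_charFun
    ext t
    have := h (-((2 * Real.pi)⁻¹ • WithLp.ofLp t))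
    rw [bT_eq, bT_eq] at this
    have e : (-((2 * Real.pi) • WithLp.toLp 2 (-((2 * Real.pi)⁻¹ • WithLp.ofLp t)))) = t := by
      have : (2 * Real.pi) ≠ 0 := by positivity
      rw [WithLp.toLp_neg, WithLp.toLp_smul, smul_neg, neg_neg, smul_smul,
        mul_inv_cancel₀ this, one_smul]
    rwa [e] at this
  have := congrArg (Measure.map (WithLp.ofLp)) key
  rw [Measure.map_map hm2 hm, Measure.map_map hm2 hm] at this
  simpa [Function.comp_def] using this

lemma BPD.bochner_fin {d : ℕ} {φ : (Fin d → ℝ) → ℂ} (h : BPD φ) (hφ : Continuous φ) :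
    ∃ m : Measure (Fin d → ℝ), IsFiniteMeasure m ∧ ∀ z, bT m z = φ z := by
  have hm : Measurable (WithLp.toLp 2 : (Fin d → ℝ) → EuclideanSpace ℝ (Fin d)) := by fun_prop
  have hm2 : Measurable (WithLp.ofLp : EuclideanSpace ℝ (Fin d) → (Fin d → ℝ)) := by fun_prop
  have h' : BPD (fun v : EuclideanSpace ℝ (Fin d) => φ (-(WithLp.ofLp v))) := by
    intro n x a
    have := h n (fun k => -(WithLp.ofLp (x k))) a
    convert this using 7
    simp; abel
  obtain ⟨μ, hμ⟩ := h'.bochner (by fun_prop)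
  refine ⟨(μ : Measure (EuclideanSpace ℝ (Fin d))).map WithLp.ofLp, inferInstance, fun z => ?_⟩
  rw [bT_eq, Measure.map_map hm hm2]
  have e := hμ (-(WithLp.toLp 2 z))
  simp only [WithLp.ofLp_neg, neg_neg] at e
  rw [← e, smul_neg]
  congr 1
  simp [Function.comp_def]

lemma integral_comb {X ι : Type*} [MeasurableSpace X] [Fintype ι] (m : ι → Measure X)
    (c : ι → NNReal) (f : X → ℂ)
    (hf : ∀ i, Integrable f (m i)) :
    Integrable f (∑ i, c i • m i) ∧
    ∫ x, f x ∂(∑ i, c i • m i) = ∑ i, (c i : ℂ) * ∫ x, f x ∂(m i) := by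
  have : ∀ i, Integrable f (c i • m i) := fun i => (hf i).smul_measure_nnreal
  refine ⟨integrable_finsetSum_measure.2 fun i _ => this i, ?_⟩
  rw [integral_finsetSum_measure (fun i _ => this i)]
  congr 1; ext i
  rw [integral_smul_nnreal_measure]
  rfl

lemma bT_real {d : ℕ} {ι : Type*} [Fintype ι] (m : ι → Measure (Fin d → ℝ))
    [∀ i, IsFiniteMeasure (m i)] (M : Measure (Fin d → ℝ)) [IsFiniteMeasure M] (r : ι → ℝ)
    (h : ∀ z, ∑ i, (r i : ℂ) * bT (m i) z = bT M z) (f : (Fin d → ℝ) → ℂ)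
    (hf : ∀ i, Integrable f (m i)) (hfM : Integrable f M) :
    ∑ i, (r i : ℂ) * ∫ x, f x ∂(m i) = ∫ x, f x ∂M := by
  have hr : ∀ i, (r i : ℂ) = ((r i).toNNReal : ℂ) - ((-r i).toNNReal : ℂ) := by
    intro i
    have : r i = ((r i).toNNReal : ℝ) - ((-r i).toNNReal : ℝ) := by
      rw [Real.coe_toNNReal', Real.coe_toNNReal']
      rcases le_total 0 (r i) with h | h <;> simp [h]
    exact_mod_cast congrArg Complex.ofReal this
  have gen : ∀ g : (Fin d → ℝ) → ℂ, (∀ i, Integrable g (m i)) → Integrable g M →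
      ((∑ i, (r i : ℂ) * ∫ x, g x ∂(m i) = ∫ x, g x ∂M) ↔
      ∫ x, g x ∂(∑ i, (r i).toNNReal • m i) = ∫ x, g x ∂(M + ∑ i, (-r i).toNNReal • m i)) := by
    intro g hg hgM
    obtain ⟨i1, e1⟩ := integral_comb m (fun i => (r i).toNNReal) g hg
    obtain ⟨i2, e2⟩ := integral_comb m (fun i => (-r i).toNNReal) g hg
    rw [integral_add_measure hgM i2, e1, e2]
    simp_rw [hr, sub_mul, Finset.sum_sub_distrib]
    exact sub_eq_iff_eq_add
  rw [gen f hf hfM]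
  congr 1
  apply bT_ext
  intro z
  exact (gen _ (fun i => bT_integrable (m i) z) (bT_integrable M z)).1 (h z)

lemma bT_complex {d : ℕ} {ι : Type*} [Fintype ι] (m : ι → Measure (Fin d → ℝ))
    [∀ i, IsFiniteMeasure (m i)] (M : Measure (Fin d → ℝ)) [IsFiniteMeasure M] (c : ι → ℂ)
    (h : ∀ z, ∑ i, c i * bT (m i) z = bT M z) (f : (Fin d → ℝ) → ℂ)
    (hf : ∀ i, Integrable f (m i)) (hfM : Integrable f M) :
    ∑ i, c i * ∫ x, f x ∂(m i) = ∫ x, f x ∂M := by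
  have h2 : ∀ z, ∑ i, conj (c i) * bT (m i) z = bT M z := by
    intro z
    have := congrArg conj (h (-z))
    simpa [bT_conj] using this
  have e1 := bT_real m M (fun i => (c i).re) (by
    intro z
    have a1 := h z
    have a2 := h2 z
    have : ∀ i, ((c i).re : ℂ) = (c i + conj (c i)) / 2 := fun i => by
      rw [Complex.re_eq_add_conj]
    simp_rw [this, add_div, add_mul, Finset.sum_add_distrib, div_mul_eq_mul_div,
      ← Finset.sum_div, a1, a2]
    ring) f hf hfM
  have e2 := bT_real m 0 (fun i => (c i).im) (by
    intro z
    have a1 := h z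
    have a2 := h2 z
    have : ∀ i, ((c i).im : ℂ) = (c i - conj (c i)) / (2 * Complex.I) := fun i => by
      rw [Complex.im_eq_sub_conj]
    simp_rw [this, sub_div, sub_mul, Finset.sum_sub_distrib, div_mul_eq_mul_div,
      ← Finset.sum_div, a1, a2]
    simp [bT]) f hf (by simp)
  rw [← e1]
  have : ∀ i, c i = (c i).re + (c i).im * Complex.I := fun i => (Complex.re_add_im _).symm
  calc _ = ∑ i, (((c i).re : ℂ) * ∫ x, f x ∂(m i) +
      Complex.I * (((c i).im : ℂ) * ∫ x, f x ∂(m i))) := by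
        refine Finset.sum_congr rfl fun i _ => ?_
        nth_rewrite 1 [this i]; ring
    _ = _ := by
      rw [Finset.sum_add_distrib, ← Finset.mul_sum, e2]; simp

lemma jordan_integral {X : Type*} [MeasurableSpace X] (P Q : Measure X) [IsFiniteMeasure P]
    [IsFiniteMeasure Q] (σ : SignedMeasure X)
    (hσ : σ = P.toSignedMeasure - Q.toSignedMeasure) (f : X → ℂ)
    (hf : ∀ m : Measure X, IsFiniteMeasure m → Integrable f m) :
    ∫ x, f x ∂σ.toJordanDecomposition.posPart - ∫ x, f x ∂σ.toJordanDecomposition.negPart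
      = ∫ x, f x ∂P - ∫ x, f x ∂Q := by
  have h := SignedMeasure.toSignedMeasure_toJordanDecomposition σ
  set p := σ.toJordanDecomposition.posPart
  set q := σ.toJordanDecomposition.negPart
  have h' : p.toSignedMeasure - q.toSignedMeasure = P.toSignedMeasure - Q.toSignedMeasure := by
    rw [← hσ]; exact h
  have h3 : p + Q = P + q := by
    rw [← Measure.toSignedMeasure_eq_toSignedMeasure_iff, Measure.toSignedMeasure_add,
      Measure.toSignedMeasure_add]
    exact sub_eq_sub_iff_add_eq_add.1 h'
  have h4 : ∫ x, f x ∂(p + Q) = ∫ x, f x ∂(P + q) := by rw [h3]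
  rw [integral_add_measure (hf _ inferInstance) (hf _ inferInstance),
    integral_add_measure (hf _ inferInstance) (hf _ inferInstance)] at h4
  exact sub_eq_sub_iff_add_eq_add.2 h4

lemma comb_BPD {d : ℕ} {S : Type*}
    (Γ : S → S → ((Fin d) → ℝ) → ℝ)
    (hcont : ∀ s₁ s₂, Continuous (Γ s₁ s₂))
    (hpsd : ∀ (n : ℕ) (s : Fin n → S) (x : Fin n → (Fin d) → ℝ) (a : Fin n → ℂ),
      (∑ k, ∑ l, a k * starRingEnd ℂ (a l) * (Γ (s k) (s l) (x k - x l) : ℂ)).im = 0 ∧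
      0 ≤ (∑ k, ∑ l, a k * starRingEnd ℂ (a l) * (Γ (s k) (s l) (x k - x l) : ℂ)).re)
    (n : ℕ) (s : Fin n → S) (a : Fin n → ℂ) :
    ∃ m : Measure (Fin d → ℝ), IsFiniteMeasure m ∧ ∀ z, bT m z =
      ∑ k, ∑ l, a k * conj (a l) * (Γ (s k) (s l) z : ℂ) := by
  apply BPD.bochner_fin
  · intro N x b
    obtain ⟨h1, h2⟩ := hpsd (N * n) (fun p => s (finProdFinEquiv.symm p).2)
      (fun p => x (finProdFinEquiv.symm p).1)
      (fun p => b (finProdFinEquiv.symm p).1 * a (finProdFinEquiv.symm p).2)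
    rw [Complex.nonneg_iff]
    have : ∑ k, ∑ l, b k * conj (b l) *
        ∑ k', ∑ l', a k' * conj (a l') * (Γ (s k') (s l') (x k - x l) : ℂ) =
      ∑ p : Fin (N * n), ∑ q : Fin (N * n),
        (b (finProdFinEquiv.symm p).1 * a (finProdFinEquiv.symm p).2) *
        conj (b (finProdFinEquiv.symm q).1 * a (finProdFinEquiv.symm q).2) *
        (Γ (s (finProdFinEquiv.symm p).2) (s (finProdFinEquiv.symm q).2)
          (x (finProdFinEquiv.symm p).1 - x (finProdFinEquiv.symm q).1) : ℂ) := by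
      symm
      rw [Equiv.sum_comp finProdFinEquiv.symm (fun p : Fin N × Fin n =>
        ∑ q : Fin (N * n), (b p.1 * a p.2) *
        conj (b (finProdFinEquiv.symm q).1 * a (finProdFinEquiv.symm q).2) *
        (Γ (s p.2) (s (finProdFinEquiv.symm q).2)
          (x p.1 - x (finProdFinEquiv.symm q).1) : ℂ)), Fintype.sum_prod_type]
      refine Finset.sum_congr rfl fun k _ => ?_
      simp_rw [Finset.mul_sum]
      rw [Finset.sum_comm (s := (Finset.univ : Finset (Fin N))) (t := (Finset.univ : Finset (Fin n)))]
      refine Finset.sum_congr rfl fun k' _ => ?_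
      rw [Equiv.sum_comp finProdFinEquiv.symm (fun q : Fin N × Fin n =>
        (b k * a k') * conj (b q.1 * a q.2) *
        (Γ (s k') (s q.2) (x k - x q.1) : ℂ)), Fintype.sum_prod_type]
      refine Finset.sum_congr rfl fun l _ => Finset.sum_congr rfl fun l' _ => ?_
      simp only [map_mul]
      ring
    rw [this]
    exact ⟨h2, h1.symm⟩
  · have := fun k l => hcont (s k) (s l)
    fun_prop

/-- weights in the polarization identity -/
noncomputable def bw : Fin 4 → ℂ := ![1, -Complex.I, -1, Complex.I]

lemma polar {d : ℕ} {S : Type*}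
    (Γ : S → S → ((Fin d) → ℝ) → ℝ)
    (hcont : ∀ s₁ s₂, Continuous (Γ s₁ s₂))
    (hpsd : ∀ (n : ℕ) (s : Fin n → S) (x : Fin n → (Fin d) → ℝ) (a : Fin n → ℂ),
      (∑ k, ∑ l, a k * starRingEnd ℂ (a l) * (Γ (s k) (s l) (x k - x l) : ℂ)).im = 0 ∧
      0 ≤ (∑ k, ∑ l, a k * starRingEnd ℂ (a l) * (Γ (s k) (s l) (x k - x l) : ℂ)).re)
    (s t : S) :
    ∃ m : Fin 4 → Measure (Fin d → ℝ), (∀ j, IsFiniteMeasure (m j)) ∧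
      ∀ z, (Γ s t z : ℂ) = ∑ j, bw j * bT (m j) z := by
  choose m hm hT using fun j : Fin 4 => comb_BPD Γ hcont hpsd 2 ![s, t] ![conj (bw j) / 2, 1 / 2]
  refine ⟨m, hm, fun z => ?_⟩
  simp_rw [hT]
  have h2 : conj (2 : ℂ) = 2 := Complex.conj_ofNat 2
  simp [Fin.sum_univ_four, Fin.sum_univ_two, bw, h2]
  ring_nf
  simp [Complex.I_sq]
  try ring

theorem stmt11_aux {d : ℕ} {S : Type*}
    (Γ : S → S → ((Fin d) → ℝ) → ℝ)
    (hcont : ∀ s₁ s₂, Continuous (Γ s₁ s₂))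
    (hpsd : ∀ (n : ℕ) (s : Fin n → S) (x : Fin n → (Fin d) → ℝ) (a : Fin n → ℂ),
      (∑ k, ∑ l, a k * starRingEnd ℂ (a l) * (Γ (s k) (s l) (x k - x l) : ℂ)).im = 0 ∧
      0 ≤ (∑ k, ∑ l, a k * starRingEnd ℂ (a l) * (Γ (s k) (s l) (x k - x l) : ℂ)).re) :
    ∃ μ : S → S → MeasureTheory.ComplexMeasure ((Fin d) → ℝ),
      (∀ s₁ s₂ z, (Γ s₁ s₂ z : ℂ) =
        cmIntegral (μ s₁ s₂) (fun ξ => Complex.exp (-(2 * Real.pi * Complex.I * (ξ ⬝ᵥ z))))) ∧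
      (∀ (n : ℕ) (s : Fin n → S) (a : Fin n → ℂ) (A : Set ((Fin d) → ℝ)),
        MeasurableSet A →
        ((∑ k, ∑ l, (a k * starRingEnd ℂ (a l)) • μ (s k) (s l)) A).im = 0 ∧
        0 ≤ ((∑ k, ∑ l, (a k * starRingEnd ℂ (a l)) • μ (s k) (s l)) A).re) := by
  choose m hm hT using polar Γ hcont hpsd
  let μ : S → S → ComplexMeasure (Fin d → ℝ) := fun s t =>
    SignedMeasure.toComplexMeasure
      ((m s t 0).toSignedMeasure - (m s t 2).toSignedMeasure)
      ((m s t 3).toSignedMeasure - (m s t 1).toSignedMeasure)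
  have happ : ∀ s t (A : Set (Fin d → ℝ)), MeasurableSet A →
      μ s t A = ∑ j, bw j * ∫ x, A.indicator (fun _ => (1 : ℂ)) x ∂(m s t j) := by
    intro s t A hA
    have : ∀ j, ∫ x, A.indicator (fun _ => (1 : ℂ)) x ∂(m s t j) = ((m s t j).real A : ℂ) := by
      intro j
      rw [integral_indicator_const _ hA]
      simp
    simp_rw [this]
    simp only [μ, SignedMeasure.toComplexMeasure_apply, Measure.toSignedMeasure_sub_apply hA]
    simp only [Fin.sum_univ_four, bw]
    apply Complex.ext <;> simp <;> ring
  refine ⟨μ, fun s t z => ?_, fun n s a A hA => ?_⟩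
  · have hi := fun (M : Measure (Fin d → ℝ)) (hM : IsFiniteMeasure M) => bT_integrable M z
    rw [cmIntegral, jordan_integral (m s t 0) (m s t 2) (μ s t).re rfl _ hi,
      jordan_integral (m s t 3) (m s t 1) (μ s t).im rfl _ hi, hT]
    simp only [Fin.sum_univ_four, bw, bT]
    simp
    ring
  · obtain ⟨M, hMf, hM⟩ := comb_BPD Γ hcont hpsd n s a
    have hi : ∀ (M : Measure (Fin d → ℝ)), IsFiniteMeasure M →
        Integrable (A.indicator (fun _ => (1 : ℂ))) M :=
      fun M _ => (integrable_const _).indicator hA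
    have key := bT_complex (ι := Fin n × Fin n × Fin 4)
      (fun p => m (s p.1) (s p.2.1) p.2.2) M
      (fun p => a p.1 * conj (a p.2.1) * bw p.2.2) (by
        intro z
        rw [hM]
        simp_rw [Fintype.sum_prod_type, hT, Finset.mul_sum, mul_assoc])
      (A.indicator (fun _ => (1 : ℂ))) (fun _ => hi _ inferInstance) (hi _ inferInstance)
    have e : (∑ k, ∑ l, (a k * conj (a l)) • μ (s k) (s l)) A = (M.real A : ℂ) := by
      rw [integral_indicator_const _ hA] at key
      simp only [Fintype.sum_prod_type] at key
      simp only [FunLike.coe_sum, Finset.sum_apply, FunLike.coe_smul, Pi.smul_apply,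
        happ _ _ A hA, smul_eq_mul, Finset.mul_sum, ← mul_assoc]
      rw [key]; simp
    rw [e]
    exact ⟨Complex.ofReal_im _, by rw [Complex.ofReal_re]; exact measureReal_nonneg⟩

end helpers

/-- parametrized Bochner theorem, hard direction: if `Γ : S × S × ℝᵈ → ℝ` is
continuous in `z` and `K((s₁,x₁),(s₂,x₂)) = Γ(s₁,s₂,x₁-x₂)` is positive semi-definite, then
there is a family of finite complex measures `μ_{s₁,s₂}` with
`Γ(s₁,s₂,z) = ∫ e^{-2πi ξᵀz} dμ_{s₁,s₂}(ξ)` which is a measure-valued positive kernel. -/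
theorem stmt11 {d : ℕ} {S : Type*}
    (Γ : S → S → ((Fin d) → ℝ) → ℝ)
    (hcont : ∀ s₁ s₂, Continuous (Γ s₁ s₂))
    (hpsd : ∀ (n : ℕ) (s : Fin n → S) (x : Fin n → (Fin d) → ℝ) (a : Fin n → ℂ),
      (∑ k, ∑ l, a k * starRingEnd ℂ (a l) * (Γ (s k) (s l) (x k - x l) : ℂ)).im = 0 ∧
      0 ≤ (∑ k, ∑ l, a k * starRingEnd ℂ (a l) * (Γ (s k) (s l) (x k - x l) : ℂ)).re) :
    ∃ μ : S → S → MeasureTheory.ComplexMeasure ((Fin d) → ℝ),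
      (∀ s₁ s₂ z, (Γ s₁ s₂ z : ℂ) =
        cmIntegral (μ s₁ s₂) (fun ξ => Complex.exp (-(2 * Real.pi * Complex.I * (ξ ⬝ᵥ z))))) ∧
      (∀ (n : ℕ) (s : Fin n → S) (a : Fin n → ℂ) (A : Set ((Fin d) → ℝ)),
        MeasurableSet A →
        ((∑ k, ∑ l, (a k * starRingEnd ℂ (a l)) • μ (s k) (s l)) A).im = 0 ∧
        0 ≤ ((∑ k, ∑ l, (a k * starRingEnd ℂ (a l)) • μ (s k) (s l)) A).re) := by
  exact stmt11_aux Γ hcont hpsd
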